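/- arXiv:2105.10652 — 8 statements merged into one kernel-verified Lean document; each statement's English description precedes it below -/
import Mathlib

section
/- Let a, b, c be real constants with c > 0, b > 0 and b² + 27ac > 0, and set s₊ = (b + √(b² + 24ac))/(4c). Then for every Q ∈ Q₀ one has F_b(Q) ≥ f_b(s₊), with equality if and only if Q = s₊(d⊗d - (1/3)I) for some unit vector d ∈ ℝ³ (i.e. Q ∈ N). -/
noncomputable section

open Matrix

/-- The space of 3×3 real matrices. -/
abbrev Mat3 := Matrix (Fin 3) (Fin 3) ℝ

/-- Frobenius inner product `A : B = ∑ᵢⱼ Aᵢⱼ Bᵢⱼ`. -/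
def frob (A B : Mat3) : ℝ := ∑ i, ∑ j, A i j * B i j

/-- Landau–de Gennes bulk energy density
`F_b(Q) = -(a/2)|Q|² - (b/3) tr(Q³) + (c/4)|Q|⁴`. -/
def Fb (a b c : ℝ) (Q : Mat3) : ℝ :=
  -(a / 2) * frob Q Q - (b / 3) * (Q * Q * Q).trace + (c / 4) * (frob Q Q) ^ 2

/-- `f_b(s) = -(a/3)s² - (2b/27)s³ + (c/9)s⁴`, the value of `F_b` at the
uniaxial matrix `s(d⊗d - (1/3)I)` for a unit vector `d`. -/
def fbulk (a b c s : ℝ) : ℝ :=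
  -(a / 3) * s ^ 2 - (2 * b / 27) * s ^ 3 + (c / 9) * s ^ 4

/-- The uniaxial matrix `s (d ⊗ d - (1/3) I)`. -/
def uniax (s : ℝ) (d : Fin 3 → ℝ) : Mat3 :=
  s • (vecMulVec d d - (1 / 3 : ℝ) • (1 : Mat3))

/-- Orthogonal diagonalization of a real symmetric matrix. -/
lemma exists_orthogonal_diagonalization (Q : Mat3) (hQ : Q.IsSymm) :
    ∃ (U : Mat3) (l : Fin 3 → ℝ), U * Uᵀ = 1 ∧ Uᵀ * U = 1 ∧ Q = U * diagonal l * Uᵀ := by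
  have hH : Q.IsHermitian := by
    rw [Matrix.IsHermitian, conjTranspose_eq_transpose_of_trivial]
    exact hQ
  refine ⟨hH.eigenvectorUnitary, hH.eigenvalues, ?_, ?_, ?_⟩
  · simpa [star_eq_conjTranspose] using Unitary.coe_mul_star_self hH.eigenvectorUnitary
  · simpa [star_eq_conjTranspose] using Unitary.coe_star_mul_self hH.eigenvectorUnitary
  · simpa [Unitary.conjStarAlgAut_apply, star_eq_conjTranspose, Function.comp_def]
      using hH.spectral_theorem

lemma frob_self_eq_trace (Q : Mat3) (hQ : Q.IsSymm) : frob Q Q = (Q * Q).trace := by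
  simp only [frob, Matrix.trace, Matrix.mul_apply, Matrix.diag_apply]
  exact Finset.sum_congr rfl fun i _ => Finset.sum_congr rfl fun j _ => by rw [hQ.apply i j]

lemma vecMulVec_self_mul_self (d : Fin 3 → ℝ) (hd : ∑ i, d i ^ 2 = 1) :
    vecMulVec d d * vecMulVec d d = vecMulVec d d := by
  have hdd : d ⬝ᵥ d = 1 := by simpa [dotProduct, sq] using hd
  rw [vecMulVec_mul_vecMulVec, hdd]
  simp

lemma trace_vecMulVec_self (d : Fin 3 → ℝ) (hd : ∑ i, d i ^ 2 = 1) :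
    (vecMulVec d d).trace = 1 := by
  simpa [Matrix.trace, vecMulVec_apply, sq] using hd

/-- On a uniaxial matrix the bulk energy density is `fbulk`. -/
lemma Fb_uniax (a b c s : ℝ) (d : Fin 3 → ℝ) (hd : ∑ i, d i ^ 2 = 1) :
    Fb a b c (uniax s d) = fbulk a b c s := by
  have hP := vecMulVec_self_mul_self d hd
  have ht := trace_vecMulVec_self d hd
  have hsym : (uniax s d).IsSymm := by
    simp [Matrix.IsSymm, uniax, transpose_vecMulVec]
  have h2 : uniax s d * uniax s d
      = s ^ 2 • ((1 / 3 : ℝ) • vecMulVec d d + (1 / 9 : ℝ) • (1 : Mat3)) := by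
    simp only [uniax, smul_mul_assoc, mul_smul_comm, sub_mul, mul_sub, hP, one_mul, mul_one]
    module
  have h3 : uniax s d * uniax s d * uniax s d
      = s ^ 3 • ((1 / 3 : ℝ) • vecMulVec d d - (1 / 27 : ℝ) • (1 : Mat3)) := by
    rw [h2]
    simp only [uniax, smul_mul_assoc, mul_smul_comm, add_mul, mul_sub, hP, one_mul, mul_one]
    module
  rw [Fb, frob_self_eq_trace _ hsym, h3, h2, fbulk]
  simp only [trace_smul, trace_add, trace_sub, trace_one, ht, smul_eq_mul, Fintype.card_fin]
  push_cast
  ring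

lemma mul_diagonal_mul_transpose_eq_uniax {U : Mat3} (hU : U * Uᵀ = 1) (hU' : Uᵀ * U = 1)
    {s : ℝ} {l : Fin 3 → ℝ} (i : Fin 3)
    (hl : l = fun j => (if j = i then s else 0) - s / 3) :
    ∃ d : Fin 3 → ℝ, (∑ k, d k ^ 2 = 1) ∧ U * diagonal l * Uᵀ = uniax s d := by
  refine ⟨fun k => U k i, ?_, ?_⟩
  · simpa [Matrix.mul_apply, sq] using congrFun (congrFun hU' i) i
  · have hD : diagonal l
        = s • diagonal (fun j => if j = i then (1 : ℝ) else 0) - (s / 3) • (1 : Mat3) := by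
      rw [hl]
      ext j k
      by_cases hjk : j = k <;> simp [hjk]
    have hV : U * diagonal (fun j => if j = i then (1 : ℝ) else 0) * Uᵀ
        = vecMulVec (fun k => U k i) (fun k => U k i) := by
      ext j k
      rw [Matrix.mul_apply]
      simp [mul_diagonal, vecMulVec_apply]
    rw [hD, mul_sub, sub_mul, mul_smul_comm, mul_smul_comm, smul_mul_assoc, smul_mul_assoc,
      hV, mul_one, hU, uniax]
    module

/-- `|tr Q³| ≤ |Q|³ / √6` for traceless `Q`, in terms of eigenvalues. -/
lemma sum_cubes_le {x y z t : ℝ} (h0 : x + y + z = 0) (ht : 0 ≤ t)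
    (htt : t ^ 2 = 3 / 2 * (x ^ 2 + y ^ 2 + z ^ 2)) :
    x ^ 3 + y ^ 3 + z ^ 3 ≤ 2 / 9 * t ^ 3 := by
  refine abs_le_of_sq_le_sq' ?_ (by positivity) |>.2
  have ht6 : (2 / 9 * t ^ 3) ^ 2 = 4 / 81 * (3 / 2 * (x ^ 2 + y ^ 2 + z ^ 2)) ^ 3 := by
    rw [← htt]; ring
  obtain rfl : z = -x - y := by linarith
  rw [ht6]
  have := sq_nonneg ((x - y) * (2 * x + y) * (x + 2 * y))
  nlinarith

lemma fbulk_sub_fbulk {a b c s : ℝ} (hcrit : 2 * c * s ^ 2 - b * s - 3 * a = 0) (t : ℝ) :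
    fbulk a b c t - fbulk a b c s
      = (t - s) ^ 2 * (c / 9 * t ^ 2 + (3 * c * s - b) / 27 * (2 * t + s)) := by
  obtain rfl : a = (2 * c * s ^ 2 - b * s) / 3 := by linarith
  simp only [fbulk]
  ring

lemma eq_or_eq_of_sum_cubes {x y z s : ℝ} (h0 : x + y + z = 0)
    (h2 : x ^ 2 + y ^ 2 + z ^ 2 = 2 / 3 * s ^ 2) (h3 : x ^ 3 + y ^ 3 + z ^ 3 = 2 / 9 * s ^ 3) :
    x = s - s / 3 ∨ x = 0 - s / 3 := by
  have hx : (x - 2 * s / 3) * (x + s / 3) ^ 2 = 0 := by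
    obtain rfl : z = -x - y := by linarith
    linear_combination x / 2 * h2 + h3 / 3
  rcases mul_eq_zero.1 hx with h | h
  · left; linarith
  · right; linarith [pow_eq_zero_iff (two_ne_zero) |>.1 h]

/-- Equality in the trace inequality forces the eigenvalues `2s/3, -s/3, -s/3`, up to order. -/
lemma exists_eq_of_sum_cubes {l : Fin 3 → ℝ} {s : ℝ} (h0 : l 0 + l 1 + l 2 = 0)
    (h2 : l 0 ^ 2 + l 1 ^ 2 + l 2 ^ 2 = 2 / 3 * s ^ 2)
    (h3 : l 0 ^ 3 + l 1 ^ 3 + l 2 ^ 3 = 2 / 9 * s ^ 3) :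
    ∃ i : Fin 3, l = fun j => (if j = i then s else 0) - s / 3 := by
  have e0 := eq_or_eq_of_sum_cubes h0 h2 h3
  have e1 : l 1 = s - s / 3 ∨ l 1 = 0 - s / 3 :=
    eq_or_eq_of_sum_cubes (y := l 2) (z := l 0) (by linarith) (by linarith) (by linarith)
  have e2 : l 2 = s - s / 3 ∨ l 2 = 0 - s / 3 :=
    eq_or_eq_of_sum_cubes (y := l 0) (z := l 1) (by linarith) (by linarith) (by linarith)
  have key (i : Fin 3) (k0 : l 0 = (if 0 = i then s else 0) - s / 3)
      (k1 : l 1 = (if 1 = i then s else 0) - s / 3)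
      (k2 : l 2 = (if 2 = i then s else 0) - s / 3) :
      l = fun j => (if j = i then s else 0) - s / 3 := by
    funext j
    fin_cases j
    exacts [k0, k1, k2]
  rcases e0 with e0 | e0
  · refine ⟨0, key 0 ?_ ?_ ?_⟩ <;> first | rw [if_pos rfl] | rw [if_neg (by decide)]
    all_goals rcases e1 with e1 | e1 <;> rcases e2 with e2 | e2 <;> linarith
  rcases e1 with e1 | e1
  · refine ⟨1, key 1 ?_ ?_ ?_⟩ <;> first | rw [if_pos rfl] | rw [if_neg (by decide)]
    all_goals rcases e2 with e2 | e2 <;> linarith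
  · refine ⟨2, key 2 ?_ ?_ ?_⟩ <;> first | rw [if_pos rfl] | rw [if_neg (by decide)]
    all_goals linarith

/-- `s₊` is a critical point of `fbulk` lying above `b / (3c)`. -/
lemma critical_point {a b c s : ℝ} (hc : 0 < c) (h : 0 < b ^ 2 + 27 * a * c)
    (hs : s = (b + Real.sqrt (b ^ 2 + 24 * a * c)) / (4 * c)) :
    2 * c * s ^ 2 - b * s - 3 * a = 0 ∧ b < 3 * c * s := by
  have hlt : b / 3 < Real.sqrt (b ^ 2 + 24 * a * c) := by
    apply Real.lt_sqrt_of_sq_lt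
    nlinarith
  have hsq := Real.sq_sqrt (show 0 ≤ b ^ 2 + 24 * a * c by nlinarith)
  set r := Real.sqrt (b ^ 2 + 24 * a * c)
  have hr : r = 4 * c * s - b := by rw [hs]; field_simp; ring
  constructor
  · rw [hr] at hsq
    have : (8 * c) * (2 * c * s ^ 2 - b * s - 3 * a) = 0 := by linarith
    exact (mul_eq_zero.1 this).resolve_left (by positivity)
  · linarith

/-- for `c > 0`, `b > 0`, `b² + 27ac > 0` and
`s₊ = (b + √(b²+24ac))/(4c)`, one has `F_b(Q) ≥ f_b(s₊)` on `Q₀`, with equality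
iff `Q = s₊(d⊗d - (1/3)I)` for some unit vector `d`, i.e. `Q ∈ N`. -/
theorem stmt1 (a b c : ℝ) (hc : 0 < c) (hb : 0 < b) (h : 0 < b ^ 2 + 27 * a * c)
    (s : ℝ) (hs : s = (b + Real.sqrt (b ^ 2 + 24 * a * c)) / (4 * c)) :
    ∀ Q : Mat3, Q.IsSymm → Q.trace = 0 →
      Fb a b c Q ≥ fbulk a b c s ∧
      (Fb a b c Q = fbulk a b c s ↔
        ∃ d : Fin 3 → ℝ, (∑ i, d i ^ 2 = 1) ∧ Q = uniax s d) := by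
  intro Q hQ htr
  obtain ⟨hcrit, hbs⟩ := critical_point hc h hs
  have hs0 : 0 < s := by
    have : 0 < 3 * c * s := hb.trans hbs
    exact (mul_pos_iff_of_pos_left (by positivity)).1 this
  obtain ⟨U, l, hU, hU', hQU⟩ := exists_orthogonal_diagonalization Q hQ
  have h2 : Q * Q = U * diagonal (l * l) * Uᵀ := by
    calc Q * Q = U * diagonal l * (Uᵀ * U) * diagonal l * Uᵀ := by rw [hQU]; noncomm_ring
      _ = U * (diagonal l * diagonal l) * Uᵀ := by rw [hU']; noncomm_ring
      _ = _ := by rw [diagonal_mul_diagonal']; rfl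
  have h3 : Q * Q * Q = U * diagonal (l * l * l) * Uᵀ := by
    calc Q * Q * Q = U * diagonal (l * l) * (Uᵀ * U) * diagonal l * Uᵀ := by
          rw [h2]; nth_rw 1 [hQU]; noncomm_ring
      _ = U * (diagonal (l * l) * diagonal l) * Uᵀ := by rw [hU']; noncomm_ring
      _ = _ := by rw [diagonal_mul_diagonal']; rfl
  have htrace (m : Fin 3 → ℝ) : (U * diagonal m * Uᵀ).trace = m 0 + m 1 + m 2 := by
    rw [Matrix.trace_mul_comm, ← mul_assoc, hU', one_mul, trace_diagonal, Fin.sum_univ_three]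
  have h0 : l 0 + l 1 + l 2 = 0 := by rw [← htrace, ← hQU, htr]
  have hp : frob Q Q = l 0 ^ 2 + l 1 ^ 2 + l 2 ^ 2 := by
    rw [frob_self_eq_trace Q hQ, h2, htrace]
    simp only [Pi.mul_apply]
    ring
  have hT : (Q * Q * Q).trace = l 0 ^ 3 + l 1 ^ 3 + l 2 ^ 3 := by
    rw [h3, htrace]
    simp only [Pi.mul_apply]
    ring
  set t := Real.sqrt (3 / 2 * frob Q Q)
  have ht : 0 ≤ t := Real.sqrt_nonneg _
  have htt : t ^ 2 = 3 / 2 * (l 0 ^ 2 + l 1 ^ 2 + l 2 ^ 2) := by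
    rw [← hp]
    exact Real.sq_sqrt (by rw [hp]; positivity)
  have hcub := sum_cubes_le h0 ht htt
  have hFb : Fb a b c Q
      = fbulk a b c t + b / 3 * (2 / 9 * t ^ 3 - (l 0 ^ 3 + l 1 ^ 3 + l 2 ^ 3)) := by
    have hp' : frob Q Q = 2 / 3 * t ^ 2 := by rw [hp]; linarith
    rw [Fb, hT, hp', fbulk]
    ring
  have hfac := fbulk_sub_fbulk hcrit t
  have hquad : 0 < c / 9 * t ^ 2 + (3 * c * s - b) / 27 * (2 * t + s) := by
    have : 0 < 3 * c * s - b := by linarith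
    positivity
  have hgap : 0 ≤ b / 3 * (2 / 9 * t ^ 3 - (l 0 ^ 3 + l 1 ^ 3 + l 2 ^ 3)) :=
    mul_nonneg (by positivity) (by linarith)
  have hfac0 : 0 ≤ (t - s) ^ 2 * (c / 9 * t ^ 2 + (3 * c * s - b) / 27 * (2 * t + s)) := by
    positivity
  refine ⟨by linarith, fun heq => ?_, ?_⟩
  · have hts : t = s := by
      have : (t - s) ^ 2 * (c / 9 * t ^ 2 + (3 * c * s - b) / 27 * (2 * t + s)) = 0 := by
        linarith
      have := (mul_eq_zero.1 this).resolve_right hquad.ne'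
      linarith [pow_eq_zero_iff (two_ne_zero) |>.1 this]
    have hcubes : l 0 ^ 3 + l 1 ^ 3 + l 2 ^ 3 = 2 / 9 * s ^ 3 := by
      have : b / 3 * (2 / 9 * t ^ 3 - (l 0 ^ 3 + l 1 ^ 3 + l 2 ^ 3)) = 0 := by linarith
      have := (mul_eq_zero.1 this).resolve_left (by positivity)
      rw [hts] at this
      linarith
    have hsq : l 0 ^ 2 + l 1 ^ 2 + l 2 ^ 2 = 2 / 3 * s ^ 2 := by
      rw [← hts]
      linarith
    rw [hQU]
    obtain ⟨i, hi⟩ := exists_eq_of_sum_cubes h0 hsq hcubes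
    exact mul_diagonal_mul_transpose_eq_uniax hU hU' i hi
  · rintro ⟨d, hd, rfl⟩
    exact Fb_uniax a b c s d hd
end
end

section
/- Let a, b, c be real constants with c > 0, b > 0 and b² + 27ac > 0, and set s₊ = (b + √(b² + 24ac))/(4c). Then f_b(s) ≥ f_b(s₊) for every s ∈ ℝ; that is, the minimum of the bulk energy over all uniaxial order parameters is attained at s = s₊. -/
noncomputable section

/-- for `c > 0`, `b > 0`, `b² + 27ac > 0` and
`s₊ = (b + √(b²+24ac))/(4c)`, one has `f_b(s) ≥ f_b(s₊)` for all `s ∈ ℝ`. -/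
theorem stmt2 (a b c : ℝ) (hc : 0 < c) (hb : 0 < b) (h : 0 < b ^ 2 + 27 * a * c)
    (sp : ℝ) (hsp : sp = (b + Real.sqrt (b ^ 2 + 24 * a * c)) / (4 * c)) :
    ∀ s : ℝ, fbulk a b c s ≥ fbulk a b c sp := by
  intro s
  have hr : 0 ≤ Real.sqrt (b ^ 2 + 24 * a * c) := Real.sqrt_nonneg _
  have hr2 : Real.sqrt (b ^ 2 + 24 * a * c) ^ 2 = b ^ 2 + 24 * a * c :=
    Real.sq_sqrt (by nlinarith [sq_nonneg b])
  generalize Real.sqrt (b ^ 2 + 24 * a * c) = r at hsp hr hr2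
  have hrp : r = 4 * c * sp - b := by rw [hsp]; field_simp; ring
  have hbr : b ≤ 3 * r := abs_le_of_sq_le_sq' (by nlinarith) (by positivity) |>.2
  have hcrit : 2 * c * sp ^ 2 - b * sp - 3 * a = 0 := by
    have h8 : 8 * c * (2 * c * sp ^ 2 - b * sp - 3 * a) = 0 := by
      rw [hrp] at hr2
      linear_combination hr2
    exact (mul_eq_zero.mp h8).resolve_left (by positivity)
  have hdiff : 81 * c * (fbulk a b c s - fbulk a b c sp) =
      (s - sp) ^ 2 * ((3 * c * s + 3 * c * sp - b) ^ 2 + b * (3 * c * sp - b)) := by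
    unfold fbulk
    linear_combination 9 * c * (s ^ 2 - sp ^ 2) * hcrit
  have hgap : 0 ≤ 3 * c * sp - b := by linarith
  have hnonneg : 0 ≤ 81 * c * (fbulk a b c s - fbulk a b c sp) := by
    rw [hdiff]
    positivity
  exact sub_nonneg.mp (nonneg_of_mul_nonneg_right hnonneg (by positivity))
end
end

section
/- Let a, b, c be real constants with c > 0, b > 0 and a > 0, and set s₊ = (b + √(b² + 24ac))/(4c) and s₋ = (b - √(b² + 24ac))/(4c). Then f_b(s₊) < f_b(s₋) < f_b(0) = 0. -/
noncomputable section

/-- The bulk energy at the critical point `(b + r) / (4c)`, where `r² = b² + 24ac`. -/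
theorem fbulk_critical {a b c r : ℝ} (hc : c ≠ 0) (hr : r ^ 2 = b ^ 2 + 24 * a * c) :
    fbulk a b c ((b + r) / (4 * c)) = (b + r) ^ 3 * (b - 3 * r) / (6912 * c ^ 3) := by
  have ha : a = (r ^ 2 - b ^ 2) / (24 * c) := by
    field_simp
    linarith
  rw [ha, fbulk]
  field_simp
  ring

/-- for `c > 0`, `b > 0`, `a > 0`, with
`s₊ = (b + √(b²+24ac))/(4c)` and `s₋ = (b - √(b²+24ac))/(4c)`, one has
`f_b(s₊) < f_b(s₋) < f_b(0) = 0`. -/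
theorem stmt3 (a b c : ℝ) (hc : 0 < c) (hb : 0 < b) (ha : 0 < a)
    (sp sm : ℝ) (hsp : sp = (b + Real.sqrt (b ^ 2 + 24 * a * c)) / (4 * c))
    (hsm : sm = (b - Real.sqrt (b ^ 2 + 24 * a * c)) / (4 * c)) :
    fbulk a b c sp < fbulk a b c sm ∧ fbulk a b c sm < fbulk a b c 0 ∧
      fbulk a b c 0 = 0 := by
  have hac : 0 < a * c := mul_pos ha hc
  set r := Real.sqrt (b ^ 2 + 24 * a * c)
  have hr : r ^ 2 = b ^ 2 + 24 * a * c := Real.sq_sqrt (by nlinarith [sq_nonneg b])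
  have hbr : b < r := Real.lt_sqrt_of_sq_lt (by linarith)
  have hr_pos : 0 < r := hb.trans hbr
  have hzero : fbulk a b c 0 = 0 := by simp [fbulk]
  have hplus := fbulk_critical hc.ne' hr
  have hminus := fbulk_critical (a := a) (b := b) (r := -r) hc.ne' (by rw [neg_sq, hr])
  rw [← sub_eq_add_neg] at hminus
  rw [hzero, hsp, hsm, hplus, hminus]
  refine ⟨?_, ?_, rfl⟩
  · have : 0 < b * r ^ 3 := by positivity
    gcongr ?_ / _
    linear_combination 16 * this
  · refine div_neg_of_neg_of_pos (mul_neg_of_neg_of_pos ?_ (by linarith)) (by positivity)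
    exact Odd.pow_neg (by decide) (by linarith)
end
end

section
/- Let a, b, c be real constants with c > 0, b > 0 and 0 ≥ a > -b²/(27c), and set s₊ = (b + √(b² + 24ac))/(4c) and s₋ = (b - √(b² + 24ac))/(4c). Then f_b(s₊) < f_b(0) ≤ f_b(s₋). -/
noncomputable section

/-- At a critical point `s` of `f_b`, i.e. where `2cs² - bs = 3a`, the energy factorizes. -/
theorem fbulk_eq_of_critical {a b c s : ℝ} (h : 2 * c * s ^ 2 - b * s = 3 * a) :
    fbulk a b c s = s ^ 3 * (b - 3 * c * s) / 27 := by
  unfold fbulk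
  linear_combination (s ^ 2 / 9) * h

/-- for `c > 0`, `b > 0`, `0 ≥ a > -b²/(27c)`, with
`s₊ = (b + √(b²+24ac))/(4c)` and `s₋ = (b - √(b²+24ac))/(4c)`, one has
`f_b(s₊) < f_b(0) ≤ f_b(s₋)`. -/
theorem stmt4 (a b c : ℝ) (hc : 0 < c) (hb : 0 < b)
    (ha1 : a ≤ 0) (ha2 : -b ^ 2 / (27 * c) < a)
    (sp sm : ℝ) (hsp : sp = (b + Real.sqrt (b ^ 2 + 24 * a * c)) / (4 * c))
    (hsm : sm = (b - Real.sqrt (b ^ 2 + 24 * a * c)) / (4 * c)) :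
    fbulk a b c sp < fbulk a b c 0 ∧ fbulk a b c 0 ≤ fbulk a b c sm := by
  have hac : -b ^ 2 < 27 * (a * c) := by
    rw [div_lt_iff₀ (by positivity)] at ha2
    linarith
  have hac' : a * c ≤ 0 := mul_nonpos_of_nonpos_of_nonneg ha1 hc.le
  set r := Real.sqrt (b ^ 2 + 24 * a * c)
  have hr : r ^ 2 = b ^ 2 + 24 * a * c := Real.sq_sqrt (by nlinarith)
  have hr1 : b / 3 < r := Real.lt_sqrt_of_sq_lt (by nlinarith)
  have hr2 : r ≤ b := Real.sqrt_le_iff.mpr ⟨hb.le, by nlinarith⟩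
  have hp : 4 * c * sp = b + r := by rw [hsp]; field_simp
  have hm : 4 * c * sm = b - r := by rw [hsm]; field_simp
  have hcp : 2 * c * sp ^ 2 - b * sp = 3 * a := by
    refine mul_left_cancel₀ (mul_pos (by norm_num : (0 : ℝ) < 8) hc).ne' ?_
    linear_combination (4 * c * sp - b + r) * hp + hr
  have hcm : 2 * c * sm ^ 2 - b * sm = 3 * a := by
    refine mul_left_cancel₀ (mul_pos (by norm_num : (0 : ℝ) < 8) hc).ne' ?_
    linear_combination (4 * c * sm - b - r) * hm + hr
  have hsp0 : 0 < sp := by rw [hsp]; exact div_pos (by linarith) (by linarith)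
  have hsm0 : 0 ≤ sm := by rw [hsm]; exact div_nonneg (by linarith) (by linarith)
  have h0 : fbulk a b c 0 = 0 := by simp [fbulk]
  rw [h0, fbulk_eq_of_critical hcp, fbulk_eq_of_critical hcm]
  constructor
  · exact div_neg_of_neg_of_pos
      (mul_neg_of_pos_of_neg (pow_pos hsp0 3) (by linarith)) (by norm_num)
  · exact div_nonneg (mul_nonneg (pow_nonneg hsm0 3) (by linarith)) (by norm_num)
end
end

section
/- Let a, b, c be real constants with c > 0, b > 0 and -b²/(27c) ≥ a ≥ -b²/(24c), and set s₊ = (b + √(b² + 24ac))/(4c) and s₋ = (b - √(b² + 24ac))/(4c). Then f_b(s₊) ≥ f_b(0) and f_b(s₋) ≥ f_b(0). -/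
noncomputable section

theorem fbulk_zero (a b c : ℝ) : fbulk a b c 0 = 0 := by
  simp [fbulk]

/-- At or above the nematic-isotropic transition, the bulk energy is nonnegative. -/
theorem fbulk_nonneg {a b c : ℝ} (hc : 0 < c) (ha : a ≤ -b ^ 2 / (27 * c)) (s : ℝ) :
    0 ≤ fbulk a b c s := by
  have hdisc : a * (27 * c) ≤ -b ^ 2 := (le_div_iff₀ (by positivity)).1 ha
  have key : fbulk a b c s =
      s ^ 2 * ((3 * c * s - b) ^ 2 + (-b ^ 2 - a * (27 * c))) / (81 * c) := by
    unfold fbulk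
    field_simp
    ring
  rw [key]
  have := sub_nonneg.2 hdisc
  positivity

/-- for `c > 0`, `b > 0`, `-b²/(27c) ≥ a ≥ -b²/(24c)`, with
`s₊ = (b + √(b²+24ac))/(4c)` and `s₋ = (b - √(b²+24ac))/(4c)`, one has
`f_b(s₊) ≥ f_b(0)` and `f_b(s₋) ≥ f_b(0)`. -/
theorem stmt5 (a b c : ℝ) (hc : 0 < c) (hb : 0 < b)
    (ha1 : a ≤ -b ^ 2 / (27 * c)) (ha2 : -b ^ 2 / (24 * c) ≤ a)
    (sp sm : ℝ) (hsp : sp = (b + Real.sqrt (b ^ 2 + 24 * a * c)) / (4 * c))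
    (hsm : sm = (b - Real.sqrt (b ^ 2 + 24 * a * c)) / (4 * c)) :
    fbulk a b c sp ≥ fbulk a b c 0 ∧ fbulk a b c sm ≥ fbulk a b c 0 := by
  rw [fbulk_zero]
  exact ⟨fbulk_nonneg hc ha1 sp, fbulk_nonneg hc ha1 sm⟩
end
end

section
/- Let a, b, c be real constants with c > 0, b > 0 and b² + 27ac > 0, and set s₊ = (b + √(b² + 24ac))/(4c). Then there exists δ* > 0 such that: for every Q ∈ Q₀ and every unit vector n ∈ ℝ³ with |Q - s₊(n⊗n - (1/3)I)| = dist(Q, N) < δ*, and every v ∈ ℝ³ with v·n = 0, one has J(Q) : (n⊗v + v⊗n) = 0; that is, J(Q) is orthogonal to the tangent space of N at the nearest point of N to Q. -/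
noncomputable section

open Matrix

/-- Frobenius norm. -/
def fnorm (A : Mat3) : ℝ := Real.sqrt (frob A A)

/-- The distance (in Frobenius norm) from `Q` to the limit manifold
`N = { s(d⊗d - (1/3)I) : |d| = 1 }`. -/
def distN (s : ℝ) (Q : Mat3) : ℝ :=
  sInf ((fun d : Fin 3 → ℝ => fnorm (Q - uniax s d)) '' {d | ∑ i, d i ^ 2 = 1})

/-- `J(Q) = -aQ - b(Q² - (1/3)|Q|² I) + c|Q|² Q`, the derivative of the bulk
energy `F_b`. -/
def Jmap (a b c : ℝ) (Q : Mat3) : Mat3 :=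
  (-a) • Q - b • (Q * Q - ((1 / 3 : ℝ) * frob Q Q) • (1 : Mat3)) +
    (c * frob Q Q) • Q

theorem frob_vecMulVec (A : Mat3) (u v : Fin 3 → ℝ) :
    frob A (vecMulVec u v) = u ⬝ᵥ A *ᵥ v := by
  simp only [frob, vecMulVec_apply, dotProduct, mulVec, Finset.mul_sum]
  exact Finset.sum_congr rfl fun i _ => Finset.sum_congr rfl fun j _ => by ring

theorem frob_add_right (A B C : Mat3) : frob A (B + C) = frob A B + frob A C := by
  simp only [frob, Matrix.add_apply, mul_add, Finset.sum_add_distrib]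

theorem frob_self_nonneg (A : Mat3) : 0 ≤ frob A A :=
  Finset.sum_nonneg fun _ _ => Finset.sum_nonneg fun _ _ => mul_self_nonneg _

/-- The squared distance from a traceless `Q` to `s (d ⊗ d - I / 3)`, for a unit vector `d`. -/
theorem frob_sub_uniax_self {Q : Mat3} (htr : Q.trace = 0) (s : ℝ) {d : Fin 3 → ℝ}
    (hd : ∑ i, d i ^ 2 = 1) :
    frob (Q - uniax s d) (Q - uniax s d) =
      frob Q Q - 2 * s * (d ⬝ᵥ Q *ᵥ d) + 2 / 3 * s ^ 2 := by
  simp only [Matrix.trace, Matrix.diag, Fin.sum_univ_three] at htr hd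
  simp [frob, uniax, vecMulVec_apply, dotProduct, mulVec, Fin.sum_univ_three, Matrix.one_apply]
  linear_combination (2 / 3 * s) * htr + s ^ 2 * (d 0 ^ 2 + d 1 ^ 2 + d 2 ^ 2 + 1 / 3) * hd

theorem distN_le (s : ℝ) (Q : Mat3) {d : Fin 3 → ℝ} (hd : ∑ i, d i ^ 2 = 1) :
    distN s Q ≤ fnorm (Q - uniax s d) := by
  refine csInf_le ⟨0, ?_⟩ ⟨d, hd, rfl⟩
  rintro _ ⟨_, _, rfl⟩
  exact Real.sqrt_nonneg _

/-- A nearest point of the limit manifold maximizes the quadratic form of `Q` on the sphere. -/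
theorem quadForm_le_of_fnorm_eq_distN {s : ℝ} (hs : 0 < s) {Q : Mat3} (htr : Q.trace = 0)
    {n : Fin 3 → ℝ} (hn : ∑ i, n i ^ 2 = 1) (hQ : fnorm (Q - uniax s n) = distN s Q)
    {d : Fin 3 → ℝ} (hd : ∑ i, d i ^ 2 = 1) :
    d ⬝ᵥ Q *ᵥ d ≤ n ⬝ᵥ Q *ᵥ n := by
  have hle := hQ.trans_le (distN_le s Q hd)
  rw [fnorm, fnorm, Real.sqrt_le_sqrt_iff (frob_self_nonneg _), frob_sub_uniax_self htr s hn,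
    frob_sub_uniax_self htr s hd] at hle
  exact le_of_mul_le_mul_left (by linarith) hs

/-- A maximizer of the quadratic form of a symmetric matrix on the sphere is an eigenvector. -/
theorem mulVec_eq_smul_of_quadForm_le {Q : Mat3} (hsymm : Q.IsSymm) {n : Fin 3 → ℝ}
    (hn : n ⬝ᵥ n = 1)
    (hmax : ∀ d : Fin 3 → ℝ, d ⬝ᵥ d = 1 → d ⬝ᵥ Q *ᵥ d ≤ n ⬝ᵥ Q *ᵥ n) :
    Q *ᵥ n = (n ⬝ᵥ Q *ᵥ n) • n := by
  set l := n ⬝ᵥ Q *ᵥ n with hl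
  have hhom (w : Fin 3 → ℝ) (hw : 0 < w ⬝ᵥ w) : w ⬝ᵥ Q *ᵥ w ≤ l * (w ⬝ᵥ w) := by
    set r := Real.sqrt (w ⬝ᵥ w) with hr
    have hr0 : 0 < r := Real.sqrt_pos.2 hw
    have hr2 : r * r = w ⬝ᵥ w := Real.mul_self_sqrt hw.le
    have hunit := hmax (r⁻¹ • w) (by
      simp only [smul_dotProduct, dotProduct_smul, smul_eq_mul, ← hr2]
      field_simp)
    simp only [mulVec_smul, smul_dotProduct, dotProduct_smul, smul_eq_mul] at hunit
    rw [← hr2]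
    calc w ⬝ᵥ Q *ᵥ w = r⁻¹ * (r⁻¹ * (w ⬝ᵥ Q *ᵥ w)) * (r * r) := by field_simp
      _ ≤ l * (r * r) := mul_le_mul_of_nonneg_right hunit (by positivity)
  have hperp (v : Fin 3 → ℝ) (hv : v ⬝ᵥ n = 0) : v ⬝ᵥ Q *ᵥ n = 0 := by
    have hnv : n ⬝ᵥ v = 0 := by rw [dotProduct_comm, hv]
    have hswap : n ⬝ᵥ Q *ᵥ v = v ⬝ᵥ Q *ᵥ n := by
      rw [dotProduct_mulVec, ← mulVec_transpose, hsymm.eq, dotProduct_comm]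
    have hvv : 0 ≤ v ⬝ᵥ v := Finset.sum_nonneg fun _ _ => mul_self_nonneg _
    have hquad (t : ℝ) :
        0 ≤ (l * (v ⬝ᵥ v) - v ⬝ᵥ Q *ᵥ v) * (t * t) + -2 * (v ⬝ᵥ Q *ᵥ n) * t + 0 := by
      have hnorm : (n + t • v) ⬝ᵥ (n + t • v) = 1 + t * t * (v ⬝ᵥ v) := by
        simp only [add_dotProduct, dotProduct_add, smul_dotProduct, dotProduct_smul, smul_eq_mul,
          hn, hv, hnv]
        ring
      have hle := hhom (n + t • v) (by
        rw [hnorm]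
        nlinarith [mul_nonneg (mul_self_nonneg t) hvv])
      rw [hnorm] at hle
      simp only [mulVec_add, mulVec_smul, add_dotProduct, dotProduct_add, smul_dotProduct,
        dotProduct_smul, smul_eq_mul, hswap, ← hl] at hle
      linarith
    have hdiscrim := discrim_le_zero hquad
    rw [discrim] at hdiscrim
    nlinarith
  have horth : (Q *ᵥ n - l • n) ⬝ᵥ n = 0 := by
    rw [sub_dotProduct, smul_dotProduct, hn, dotProduct_comm, ← hl]
    simp
  have hself : (Q *ᵥ n - l • n) ⬝ᵥ (Q *ᵥ n - l • n) = 0 := by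
    rw [dotProduct_sub, hperp _ horth, dotProduct_smul, horth]
    simp
  exact sub_eq_zero.1 (dotProduct_self_eq_zero.1 hself)

theorem Jmap_isSymm (a b c : ℝ) {Q : Mat3} (hQ : Q.IsSymm) : (Jmap a b c Q).IsSymm := by
  simp [Matrix.IsSymm, Jmap, hQ.eq]

theorem Jmap_mulVec (a b c : ℝ) {Q : Mat3} {n : Fin 3 → ℝ} {l : ℝ} (hn : Q *ᵥ n = l • n) :
    Jmap a b c Q *ᵥ n =
      (-a * l - b * (l * l - 1 / 3 * frob Q Q) + c * frob Q Q * l) • n := by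
  simp only [Jmap, add_mulVec, sub_mulVec, smul_mulVec, ← mulVec_mulVec, hn, mulVec_smul,
    one_mulVec]
  module

/-- for `c > 0`, `b > 0`, `b² + 27ac > 0` and
`s₊ = (b + √(b²+24ac))/(4c)`, there is `δ* > 0` such that whenever `Q ∈ Q₀`,
`n` is a unit vector with `|Q - s₊(n⊗n - I/3)| = dist(Q,N) < δ*`, and
`v ⊥ n`, one has `J(Q) : (n⊗v + v⊗n) = 0`. -/
theorem stmt7 (a b c : ℝ) (hc : 0 < c) (hb : 0 < b) (h : 0 < b ^ 2 + 27 * a * c)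
    (s : ℝ) (hs : s = (b + Real.sqrt (b ^ 2 + 24 * a * c)) / (4 * c)) :
    ∃ δ : ℝ, 0 < δ ∧
      ∀ Q : Mat3, Q.IsSymm → Q.trace = 0 →
        ∀ n : Fin 3 → ℝ, (∑ i, n i ^ 2 = 1) →
          fnorm (Q - uniax s n) = distN s Q → distN s Q < δ →
            ∀ v : Fin 3 → ℝ, (∑ i, v i * n i = 0) →
              frob (Jmap a b c Q) (vecMulVec n v + vecMulVec v n) = 0 := by
  have hs0 : 0 < s := by rw [hs]; positivity
  refine ⟨1, one_pos, fun Q hsymm htr n hn hQ _ v hv => ?_⟩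
  have hsq (d : Fin 3 → ℝ) : ∑ i, d i ^ 2 = d ⬝ᵥ d := by simp only [dotProduct, sq]
  have heig := mulVec_eq_smul_of_quadForm_le hsymm ((hsq n).symm.trans hn)
    fun d hd => quadForm_le_of_fnorm_eq_distN hs0 htr hn hQ ((hsq d).trans hd)
  have hvn : v ⬝ᵥ n = 0 := hv
  have hswap : n ⬝ᵥ Jmap a b c Q *ᵥ v = v ⬝ᵥ Jmap a b c Q *ᵥ n := by
    rw [dotProduct_mulVec, ← mulVec_transpose, (Jmap_isSymm a b c hsymm).eq, dotProduct_comm]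
  rw [frob_add_right, frob_vecMulVec, frob_vecMulVec, hswap, Jmap_mulVec a b c heig,
    dotProduct_smul, hvn]
  simp
end
end

section
/- Let a, b, c be real constants with c > 0, b > 0 and b² + 24ac > 0, and set s₊ = (b + √(b² + 24ac))/(4c). Then there exists δ > 0 such that for all λ₁, λ₂ ∈ ℝ with |λ₁ + s₊/3| ≤ δ and |λ₂ + s₊/3| ≤ δ, and all vectors u, v ∈ ℝ²: 2c(2λ₁ + λ₂)²|u|² + 2c(2λ₂ + λ₁)²|v|² + 2[2c(2λ₁ + λ₂) + b](2λ₂ + λ₁)(u·v) ≥ 0. -/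
noncomputable section

/-- A binary quadratic form `2c p² x² + 2c q² y² + 2 k q x y` with `c > 0` and `k² ≤ (2cp)²` is
nonnegative. -/
theorem quadratic_form_nonneg_of_sq_le {c p k : ℝ} (hc : 0 < c) (hk : k ^ 2 ≤ (2 * c * p) ^ 2)
    (q x y : ℝ) :
    0 ≤ 2 * c * p ^ 2 * x ^ 2 + 2 * c * q ^ 2 * y ^ 2 + 2 * k * q * (x * y) := by
  refine nonneg_of_mul_nonneg_right (a := 2 * c) ?_ (by positivity)
  linear_combination sq_nonneg (k * x + 2 * c * q * y) + mul_le_mul_of_nonneg_right hk (sq_nonneg x)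

/-- for `c > 0`, `b > 0`, `b² + 24ac > 0` and
`s₊ = (b + √(b²+24ac))/(4c)`, there is `δ > 0` such that for all
`λ₁, λ₂` with `|λ₁ + s₊/3| ≤ δ`, `|λ₂ + s₊/3| ≤ δ` and all `u, v ∈ ℝ²`:
`2c(2λ₁+λ₂)²|u|² + 2c(2λ₂+λ₁)²|v|² + 2[2c(2λ₁+λ₂)+b](2λ₂+λ₁)(u·v) ≥ 0`. -/
theorem stmt13 (a b c : ℝ) (hc : 0 < c) (hb : 0 < b)
    (h : 0 < b ^ 2 + 24 * a * c)
    (s : ℝ) (hs : s = (b + Real.sqrt (b ^ 2 + 24 * a * c)) / (4 * c)) :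
    ∃ δ : ℝ, 0 < δ ∧
      ∀ l₁ l₂ : ℝ, |l₁ + s / 3| ≤ δ → |l₂ + s / 3| ≤ δ →
        ∀ u v : Fin 2 → ℝ,
          2 * c * (2 * l₁ + l₂) ^ 2 * (∑ i, u i ^ 2) +
            2 * c * (2 * l₂ + l₁) ^ 2 * (∑ i, v i ^ 2) +
            2 * (2 * c * (2 * l₁ + l₂) + b) * (2 * l₂ + l₁) *
              (∑ i, u i * v i) ≥ 0 := by
  have hr : 0 < √(b ^ 2 + 24 * a * c) := Real.sqrt_pos.mpr h
  refine ⟨√(b ^ 2 + 24 * a * c) / (12 * c), by positivity, fun l₁ l₂ h₁ h₂ u v => ?_⟩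
  have hp : 4 * c * (2 * l₁ + l₂) ≤ -b := by
    have hle : 2 * l₁ + l₂ ≤ 3 * (√(b ^ 2 + 24 * a * c) / (12 * c)) - s := by
      linarith [(abs_le.mp h₁).2, (abs_le.mp h₂).2]
    calc 4 * c * (2 * l₁ + l₂)
        ≤ 4 * c * (3 * (√(b ^ 2 + 24 * a * c) / (12 * c)) - s) := by gcongr
      _ = -b := by rw [hs]; field_simp; ring
  have hk : (2 * c * (2 * l₁ + l₂) + b) ^ 2 ≤ (2 * c * (2 * l₁ + l₂)) ^ 2 :=
    sq_le_sq' (by linarith) (by linarith) |>.trans_eq (neg_sq _)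
  simp only [Finset.mul_sum, ← Finset.sum_add_distrib, ge_iff_le]
  exact Finset.sum_nonneg fun i _ =>
    quadratic_form_nonneg_of_sq_le hc hk (2 * l₂ + l₁) (u i) (v i)
end
end

section
/- Let s ∈ ℝ, let U ⊂ ℝ² be open, and let d : U → ℝ³ be twice continuously differentiable with |d(y)| = 1 for every y ∈ U. Define Q(y) = s(d(y)⊗d(y) - (1/3)I) and let Δ = ∂₁₁ + ∂₂₂. Then at every point of U: |ΔQ|² = 2s²( |Δd|² + |∇d|⁴ + 2Σ_{k,l=1}^{2}(∂_k d · ∂_l d)² ), where |∇d|² = Σ_{k=1}^{2}|∂_k d|² and |ΔQ| is the Frobenius norm. -/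
noncomputable section

/-- Partial derivative in the `k`-th coordinate direction of `ℝ²`. -/
def pd {E : Type*} [NormedAddCommGroup E] [NormedSpace ℝ E]
    (k : Fin 2) (f : (Fin 2 → ℝ) → E) (x : Fin 2 → ℝ) : E :=
  fderiv ℝ f x (Pi.single k 1)

/-- Frobenius inner product of 3×3 arrays. -/
def frobP (A B : Fin 3 → Fin 3 → ℝ) : ℝ := ∑ i, ∑ j, A i j * B i j

theorem pd_congr {E : Type*} [NormedAddCommGroup E] [NormedSpace ℝ E] {k : Fin 2}
    {f g : (Fin 2 → ℝ) → E} {U : Set (Fin 2 → ℝ)} (hU : IsOpen U) (h : ∀ y ∈ U, f y = g y)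
    {x : Fin 2 → ℝ} (hx : x ∈ U) : pd k f x = pd k g x := by
  have hfg : f =ᶠ[nhds x] g := Filter.eventuallyEq_of_mem (hU.mem_nhds hx) h
  simp only [pd, hfg.fderiv_eq]

theorem pd_apply {ι : Type*} [Fintype ι] {E : ι → Type*} [∀ i, NormedAddCommGroup (E i)]
    [∀ i, NormedSpace ℝ (E i)] {k : Fin 2} {f : (Fin 2 → ℝ) → ∀ i, E i} {x : Fin 2 → ℝ}
    (hf : DifferentiableAt ℝ f x) (i : ι) : pd k f x i = pd k (fun y => f y i) x := by
  have h := (hasFDerivAt_pi'.1 hf.hasFDerivAt i).fderiv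
  simp [pd, h]

theorem pd_mul {k : Fin 2} {f g : (Fin 2 → ℝ) → ℝ} {x : Fin 2 → ℝ}
    (hf : DifferentiableAt ℝ f x) (hg : DifferentiableAt ℝ g x) :
    pd k (fun y => f y * g y) x = pd k f x * g x + f x * pd k g x := by
  simp only [pd, fderiv_fun_mul hf hg, add_apply,
    smul_apply, smul_eq_mul]
  ring

theorem pd_add {k : Fin 2} {f g : (Fin 2 → ℝ) → ℝ} {x : Fin 2 → ℝ}
    (hf : DifferentiableAt ℝ f x) (hg : DifferentiableAt ℝ g x) :
    pd k (fun y => f y + g y) x = pd k f x + pd k g x := by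
  simp only [pd, fderiv_fun_add hf hg, add_apply]

theorem pd_sub_const {k : Fin 2} {f : (Fin 2 → ℝ) → ℝ} {x : Fin 2 → ℝ} (c : ℝ) :
    pd k (fun y => f y - c) x = pd k f x := by
  simp only [pd, fderiv_sub_const]

theorem pd_const_mul {k : Fin 2} {f : (Fin 2 → ℝ) → ℝ} {x : Fin 2 → ℝ} (c : ℝ)
    (hf : DifferentiableAt ℝ f x) : pd k (fun y => c * f y) x = c * pd k f x := by
  simp [pd, fderiv_const_mul hf]

theorem pd_sum {ι : Type*} [Fintype ι] {k : Fin 2} {f : ι → (Fin 2 → ℝ) → ℝ} {x : Fin 2 → ℝ}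
    (hf : ∀ i, DifferentiableAt ℝ (f i) x) :
    pd k (fun y => ∑ i, f i y) x = ∑ i, pd k (f i) x := by
  simp [pd, fderiv_fun_sum fun i _ => hf i]

theorem differentiableAt_pd {E : Type*} [NormedAddCommGroup E] [NormedSpace ℝ E]
    {f : (Fin 2 → ℝ) → E} {U : Set (Fin 2 → ℝ)} (hU : IsOpen U) (hf : ContDiffOn ℝ 2 f U)
    {x : Fin 2 → ℝ} (hx : x ∈ U) (k : Fin 2) : DifferentiableAt ℝ (pd k f) x := by
  have h : ContDiffOn ℝ 1 (fderiv ℝ f) U := hf.fderiv_of_isOpen hU (by norm_num)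
  have h' : DifferentiableAt ℝ (fderiv ℝ f) x :=
    (h.differentiableOn (by norm_num)).differentiableAt (hU.mem_nhds hx)
  unfold pd
  fun_prop

/-- A unit field is orthogonal to its partial derivatives. -/
theorem sum_mul_pd_eq_zero {U : Set (Fin 2 → ℝ)} (hU : IsOpen U) {d : (Fin 2 → ℝ) → Fin 3 → ℝ}
    (hd : ContDiffOn ℝ 2 d U) (hunit : ∀ y ∈ U, ∑ i, d y i ^ 2 = 1) (k : Fin 2)
    {x : Fin 2 → ℝ} (hx : x ∈ U) : ∑ i, d x i * pd k d x i = 0 := by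
  have hdx : DifferentiableAt ℝ d x :=
    (hd.differentiableOn (by norm_num)).differentiableAt (hU.mem_nhds hx)
  have hi := differentiableAt_pi.1 hdx
  have h : pd k (fun y => ∑ i, d y i * d y i) x = pd k (fun _ => (1 : ℝ)) x :=
    pd_congr hU (fun y hy => by simpa only [sq] using hunit y hy) hx
  rw [pd_sum fun i => (hi i).fun_mul (hi i)] at h
  simp only [pd_mul (hi _) (hi _), ← pd_apply hdx] at h
  have h0 : pd k (fun _ => (1 : ℝ)) x = 0 := by simp [pd]
  rw [h0] at h
  simp only [Fin.sum_univ_three] at h ⊢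
  linarith

theorem sum_mul_pd_pd_eq_neg {U : Set (Fin 2 → ℝ)} (hU : IsOpen U)
    {d : (Fin 2 → ℝ) → Fin 3 → ℝ} (hd : ContDiffOn ℝ 2 d U)
    (hunit : ∀ y ∈ U, ∑ i, d y i ^ 2 = 1) (k : Fin 2) {x : Fin 2 → ℝ} (hx : x ∈ U) :
    ∑ i, d x i * pd k (pd k d) x i = -∑ i, pd k d x i ^ 2 := by
  have hdx : DifferentiableAt ℝ d x :=
    (hd.differentiableOn (by norm_num)).differentiableAt (hU.mem_nhds hx)
  have hpx := differentiableAt_pd hU hd hx k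
  have hi := differentiableAt_pi.1 hdx
  have hpi := differentiableAt_pi.1 hpx
  have h : pd k (fun y => ∑ i, d y i * pd k d y i) x = pd k (fun _ => (0 : ℝ)) x :=
    pd_congr hU (fun y hy => sum_mul_pd_eq_zero hU hd hunit k hy) hx
  rw [pd_sum fun i => (hi i).fun_mul (hpi i)] at h
  simp only [pd_mul (hi _) (hpi _), ← pd_apply hdx, ← pd_apply hpx] at h
  have h0 : pd k (fun _ => (0 : ℝ)) x = 0 := by simp [pd]
  rw [h0] at h
  simp only [Fin.sum_univ_three] at h ⊢
  linarith

/-- Second pure partial derivatives of the tensor `s (d ⊗ d - C)` with `C` constant. -/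
theorem pd_pd_tensor (s : ℝ) (C : Fin 3 → Fin 3 → ℝ) {U : Set (Fin 2 → ℝ)} (hU : IsOpen U)
    {d : (Fin 2 → ℝ) → Fin 3 → ℝ} (hd : ContDiffOn ℝ 2 d U) (k : Fin 2) {x : Fin 2 → ℝ}
    (hx : x ∈ U) (i j : Fin 3) :
    pd k (pd k fun y i j => s * (d y i * d y j - C i j)) x i j =
      s * (pd k (pd k d) x i * d x j + 2 * (pd k d x i * pd k d x j) +
        d x i * pd k (pd k d) x j) := by
  have hdy : ∀ y ∈ U, DifferentiableAt ℝ d y := fun y hy =>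
    (hd.differentiableOn (by norm_num)).differentiableAt (hU.mem_nhds hy)
  have hfirst : ∀ y ∈ U, (pd k fun y i j => s * (d y i * d y j - C i j)) y =
      fun i j => s * (pd k d y i * d y j + d y i * pd k d y j) := by
    intro y hy
    have hi := differentiableAt_pi.1 (hdy y hy)
    have hij : ∀ i j, DifferentiableAt ℝ (fun y => s * (d y i * d y j - C i j)) y :=
      fun i j => (((hi i).fun_mul (hi j)).sub_const _).const_mul s
    funext i j
    rw [pd_apply (differentiableAt_pi.2 fun i => differentiableAt_pi.2 (hij i)),
      pd_apply (differentiableAt_pi.2 (hij i)),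
      pd_const_mul s (((hi i).fun_mul (hi j)).sub_const _), pd_sub_const, pd_mul (hi i) (hi j),
      pd_apply (hdy y hy), pd_apply (hdy y hy)]
  have hpx := differentiableAt_pd hU hd hx k
  have hi := differentiableAt_pi.1 (hdy x hx)
  have hpi := differentiableAt_pi.1 hpx
  have hij : ∀ i j, DifferentiableAt ℝ
      (fun y => s * (pd k d y i * d y j + d y i * pd k d y j)) x :=
    fun i j => (((hpi i).fun_mul (hi j)).fun_add ((hi i).fun_mul (hpi j))).const_mul s
  rw [pd_congr hU hfirst hx,
    pd_apply (differentiableAt_pi.2 fun i => differentiableAt_pi.2 (hij i)),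
    pd_apply (differentiableAt_pi.2 (hij i)),
    pd_const_mul s (((hpi i).fun_mul (hi j)).fun_add ((hi i).fun_mul (hpi j))),
    pd_add ((hpi i).fun_mul (hi j)) ((hi i).fun_mul (hpi j)), pd_mul (hpi i) (hi j),
    pd_mul (hi i) (hpi j), ← pd_apply (hdy x hx), ← pd_apply (hdy x hx), ← pd_apply hpx,
    ← pd_apply hpx]
  ring

/-- The Frobenius norm of `s (w ⊗ v + v ⊗ w + 2 (a ⊗ a + b ⊗ b))` for a unit vector `v` orthogonal
to `a` and `b`. -/
theorem frobP_tensor (s : ℝ) (v w a b : Fin 3 → ℝ) (hv : ∑ i, v i ^ 2 = 1)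
    (ha : ∑ i, v i * a i = 0) (hb : ∑ i, v i * b i = 0) (A : Fin 3 → Fin 3 → ℝ)
    (hA : ∀ i j, A i j = s * (w i * v j + v i * w j + 2 * (a i * a j + b i * b j))) :
    frobP A A = 2 * s ^ 2 * (∑ i, w i ^ 2 + (∑ i, v i * w i) ^ 2 +
      2 * ((∑ i, a i * a i) ^ 2 + 2 * (∑ i, a i * b i) ^ 2 + (∑ i, b i * b i) ^ 2)) := by
  have h : frobP A A = 2 * s ^ 2 * ((∑ i, w i ^ 2) * (∑ i, v i ^ 2) + (∑ i, v i * w i) ^ 2 +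
      2 * ((∑ i, a i * a i) ^ 2 + 2 * (∑ i, a i * b i) ^ 2 + (∑ i, b i * b i) ^ 2) +
      4 * ((∑ i, v i * a i) * (∑ i, w i * a i) + (∑ i, v i * b i) * (∑ i, w i * b i))) := by
    simp only [frobP, hA, Fin.sum_univ_three]
    ring
  rw [h, hv, ha, hb]
  ring

/-- if `d : U → ℝ³` is `C²` on the open set `U ⊆ ℝ²` with
`|d| ≡ 1`, and `Q(y) = s(d(y)⊗d(y) - (1/3)I)`, then at every point of `U`:
`|ΔQ|² = 2s²(|Δd|² + |∇d|⁴ + 2∑ₖₗ(∂ₖd·∂ₗd)²)`. -/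
theorem stmt16 (s : ℝ) (U : Set (Fin 2 → ℝ)) (hU : IsOpen U)
    (d : (Fin 2 → ℝ) → (Fin 3 → ℝ))
    (hd : ContDiffOn ℝ 2 d U)
    (hunit : ∀ y ∈ U, ∑ i, d y i ^ 2 = 1) :
    let Q : (Fin 2 → ℝ) → (Fin 3 → Fin 3 → ℝ) :=
      fun y i j => s * (d y i * d y j - if i = j then (1 : ℝ) / 3 else 0)
    ∀ x ∈ U,
      frobP (pd 0 (pd 0 Q) x + pd 1 (pd 1 Q) x)
            (pd 0 (pd 0 Q) x + pd 1 (pd 1 Q) x) =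
        2 * s ^ 2 *
          ((∑ i, (pd 0 (pd 0 d) x i + pd 1 (pd 1 d) x i) ^ 2) +
            (∑ k : Fin 2, ∑ i, (pd k d x i) ^ 2) ^ 2 +
            2 * ∑ k : Fin 2, ∑ l : Fin 2,
              (∑ i, pd k d x i * pd l d x i) ^ 2) := by
  intro Q x hx
  have hw : ∑ i, d x i * (pd 0 (pd 0 d) x i + pd 1 (pd 1 d) x i) =
      -∑ k : Fin 2, ∑ i, pd k d x i ^ 2 := by
    simp only [mul_add, Finset.sum_add_distrib, Fin.sum_univ_two,
      sum_mul_pd_pd_eq_neg hU hd hunit _ hx]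
    ring
  rw [frobP_tensor s (d x) (fun i => pd 0 (pd 0 d) x i + pd 1 (pd 1 d) x i) (pd 0 d x) (pd 1 d x)
    (hunit x hx) (sum_mul_pd_eq_zero hU hd hunit 0 hx) (sum_mul_pd_eq_zero hU hd hunit 1 hx),
    hw, neg_sq]
  · have hsymm : ∑ i, pd 1 d x i * pd 0 d x i = ∑ i, pd 0 d x i * pd 1 d x i :=
      Finset.sum_congr rfl fun i _ => mul_comm _ _
    simp only [Fin.sum_univ_two, hsymm]
    ring
  · intro i j
    simp only [Pi.add_apply, Q,
      pd_pd_tensor s (fun i j => if i = j then (1 : ℝ) / 3 else 0) hU hd _ hx]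
    ring
end
end
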